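/- Let (X, d, μ) be a metric measure space whose measure is Ahlfors ν-regular with constants 0 < c₁ ≤ c₂ < ∞ satisfying 2^{1−ν}·(c₂/c₁) < 1, and let K be a kernel satisfying the size condition and the pseudo-radial null condition. Let f : X → ℝ be locally integrable and let g : X → [0,∞] be locally integrable such that the pair (f, g) satisfies a weak (1, ρ')-Poincaré–Sobolev inequality for some 1 < ρ' < ν. Suppose g belongs to the Morrey space M^{p,q}_μ(X) for some 1 < p ≤ q < ∞ with q/ν < 1, and let r, m be exponents with (1 − q/ν)·r > 1 and (1 − q/ν)·m > 1 such that g ∈ L^{(1−q/ν)r,(1−q/ν)m}(μ). Then there is a constant C such that the Lorentz-space inequality ‖T*_K f‖_{L^{r,m}(μ)} ≤ C · ‖g‖_{L^{(1−q/ν)r,(1−q/ν)m}(μ)}^{1 − q/ν} · ‖g‖_{M^{p,q}}^{q/ν} holds. -/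

import Mathlib

open MeasureTheory Metric ENNReal

variable {X : Type*} [MetricSpace X] [MeasurableSpace X] [BorelSpace X]

/-- Riesz-type potential `R_{s,μ} g (x) = ∫ d(x,y)^s / μ(B(x,d(x,y))) · g(y) dμ(y)`,
for `g : X → [0,∞]`, valued in `[0,∞]`. -/
noncomputable def rieszPot (μ : Measure X) (s : ℝ) (g : X → ℝ≥0∞) (x : X) : ℝ≥0∞ :=
  ∫⁻ y, (ENNReal.ofReal (dist x y ^ s) / μ (ball x (dist x y))) * g y ∂μ

/-- Riesz-type potential applied to a real (signed) function, as a Bochner integral. -/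
noncomputable def rieszR (μ : Measure X) (s : ℝ) (f : X → ℝ) (x : X) : ℝ :=
  ∫ y, (dist x y ^ s / (μ (ball x (dist x y))).toReal) * f y ∂μ

/-- Hardy–Littlewood maximal function: sup over open balls containing `x`. -/
noncomputable def maximalFn (μ : Measure X) (g : X → ℝ≥0∞) (x : X) : ℝ≥0∞ :=
  ⨆ (z : X) (r : ℝ) (_ : 0 < r) (_ : x ∈ ball z r),
    (μ (ball z r))⁻¹ * ∫⁻ y in ball z r, g y ∂μ

/-- Morrey norm `‖g‖_{M^{p,q}}`, valued in `[0,∞]`. -/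
noncomputable def morreyNorm (μ : Measure X) (p q : ℝ) (g : X → ℝ≥0∞) : ℝ≥0∞ :=
  ⨆ (z : X) (r : ℝ) (_ : 0 < r),
    (μ (ball z r) ^ (p / q - 1) * ∫⁻ y in ball z r, g y ^ p ∂μ) ^ (1 / p)

/-- Truncated singular integral `T^ε_K f (x)`. -/
noncomputable def truncT (μ : Measure X) (K : X → X → ℝ) (f : X → ℝ) (ε : ℝ) (x : X) : ℝ :=
  ∫ y in {y | ε < dist x y}, K x y * f y ∂μ

/-- Maximal singular operator `T^*_K f (x) = sup_{ε>0} |T^ε_K f (x)|`, valued in `[0,∞]`. -/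
noncomputable def maxT (μ : Measure X) (K : X → X → ℝ) (f : X → ℝ) (x : X) : ℝ≥0∞ :=
  ⨆ (ε : ℝ) (_ : 0 < ε), ENNReal.ofReal |truncT μ K f ε x|

/-- Ahlfors `ν`-regularity: `c₁ r^ν ≤ μ(B(x,r)) ≤ c₂ r^ν`. -/
def IsAhlfors (μ : Measure X) (c₁ c₂ ν : ℝ) : Prop :=
  ∀ (x : X) (r : ℝ), 0 < r →
    ENNReal.ofReal (c₁ * r ^ ν) ≤ μ (ball x r) ∧ μ (ball x r) ≤ ENNReal.ofReal (c₂ * r ^ ν)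

/-- Size condition on the kernel: `|K(x,y)| ≤ C_K / d(x,y)^ν` for `x ≠ y`. -/
def SizeCond (K : X → X → ℝ) (CK ν : ℝ) : Prop :=
  ∀ x y : X, x ≠ y → |K x y| ≤ CK / dist x y ^ ν

/-- Pseudo-radial null condition: `∫_{a < d(x,y) < b} K(x,y) dμ(y) = 0`. -/
def NullCond (μ : Measure X) (K : X → X → ℝ) : Prop :=
  ∀ (x : X) (a b : ℝ), 0 < a → a < b →
    ∫ y in {y | a < dist x y ∧ dist x y < b}, K x y ∂μ = 0

/-- Weak `(1,ρ')`-Poincaré–Sobolev inequality for the pair `(f,g)` with constants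
`C_P > 0` and dilation `σ`. -/
def PoincareSobolev (μ : Measure X) (f : X → ℝ) (g : X → ℝ≥0∞) (ρ' CP σ : ℝ) : Prop :=
  ∀ (x : X) (r : ℝ), 0 < r →
    ((μ (ball x r))⁻¹ *
        ∫⁻ y in ball x r, ENNReal.ofReal (|f y - ⨍ z in ball x r, f z ∂μ| ^ ρ') ∂μ) ^ (1 / ρ')
      ≤ ENNReal.ofReal (CP * r) *
        ((μ (ball x (σ * r)))⁻¹ * ∫⁻ y in ball x (σ * r), g y ∂μ)

/-- Local integrability for an `[0,∞]`-valued function: measurable with finite integral on balls. -/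
def LocIntE (μ : Measure X) (g : X → ℝ≥0∞) : Prop :=
  Measurable g ∧ ∀ (z : X) (r : ℝ), ∫⁻ y in ball z r, g y ∂μ < ∞

/-- `L^r` norm (in `[0,∞]`) of an `[0,∞]`-valued function. -/
noncomputable def lpNormE (μ : Measure X) (r : ℝ) (h : X → ℝ≥0∞) : ℝ≥0∞ :=
  (∫⁻ x, h x ^ r ∂μ) ^ (1 / r)

/-- Lorentz `L^{r,m}` quasinorm (in `[0,∞]`) of an `[0,∞]`-valued function. -/
noncomputable def lorentzNormE (μ : Measure X) (r m : ℝ) (h : X → ℝ≥0∞) : ℝ≥0∞ :=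
  ENNReal.ofReal (r ^ (1 / m)) *
    (∫⁻ α in Set.Ioi (0 : ℝ),
        (ENNReal.ofReal α * μ {x | ENNReal.ofReal α < h x} ^ (1 / r)) ^ m *
          ENNReal.ofReal α⁻¹) ^ (1 / m)


namespace IsAhlfors

variable {μ : Measure X} {c₁ c₂ ν : ℝ}

omit [BorelSpace X] in
lemma measure_ball_pos (hA : IsAhlfors μ c₁ c₂ ν) (hc₁ : 0 < c₁) (x : X) {r : ℝ} (hr : 0 < r) :
    0 < μ (ball x r) :=
  (ENNReal.ofReal_pos.2 (by positivity)).trans_le (hA x r hr).1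

omit [BorelSpace X] in
lemma measure_ball_lt_top (hA : IsAhlfors μ c₁ c₂ ν) (x : X) (r : ℝ) : μ (ball x r) < ∞ := by
  rcases lt_or_ge 0 r with hr | hr
  · exact (hA x r hr).2.trans_lt ENNReal.ofReal_lt_top
  · simp [ball_eq_empty.2 hr]

omit [BorelSpace X] in
lemma sigmaFinite (hA : IsAhlfors μ c₁ c₂ ν) : SigmaFinite μ := by
  rcases isEmpty_or_nonempty X with h | ⟨⟨x⟩⟩
  · rw [Measure.eq_zero_of_isEmpty μ]
    infer_instance
  · exact ⟨⟨⟨fun n : ℕ => ball x n, fun _ => trivial, fun n => hA.measure_ball_lt_top x n,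
      iUnion_ball_nat x⟩⟩⟩

lemma secondCountableTopology (hA : IsAhlfors μ c₁ c₂ ν) (hc₁ : 0 < c₁) :
    SecondCountableTopology X := by
  have := hA.sigmaFinite
  refine Metric.secondCountable_of_almost_dense_set fun ε hε => ?_
  obtain ⟨u, -, hu, hcov⟩ := Vitali.exists_disjoint_subfamily_covering_enlargement_closedBall
    (Set.univ : Set X) id (fun _ => ε / 4) (ε / 4) (fun _ _ => le_rfl) 4 (by norm_num)
  refine ⟨u, ?_, fun x => ?_⟩
  · have hc := Measure.countable_meas_pos_of_disjoint_iUnion (μ := μ)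
      (As := fun i : u => closedBall (i : X) (ε / 4)) (fun i => measurableSet_closedBall)
      (fun i j hij => hu i.2 j.2 (Subtype.coe_injective.ne hij))
    have huniv : {i : u | 0 < μ (closedBall (i : X) (ε / 4))} = Set.univ :=
      Set.eq_univ_of_forall fun i => (hA.measure_ball_pos hc₁ (i : X) (by positivity)).trans_le
        (measure_mono ball_subset_closedBall)
    rw [huniv] at hc
    exact Set.countable_coe_iff.1 (Set.countable_univ_iff.1 hc)
  · obtain ⟨y, hy, hsub⟩ := hcov x trivial
    refine ⟨y, hy, ?_⟩
    have := hsub (mem_closedBall_self (by positivity))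
    rw [mem_closedBall] at this
    simpa [mul_div_cancel₀] using this.trans (by linarith)

omit [BorelSpace X] in
/-- Doubling for balls, with dilation factor `c`. -/
lemma measure_ball_mul_le (hA : IsAhlfors μ c₁ c₂ ν) (hc₁ : 0 < c₁) (hc₂ : 0 < c₂) (x : X)
    {c r : ℝ} (hc : 0 < c) (hr : 0 < r) :
    μ (ball x (c * r)) ≤ ENNReal.ofReal (c₂ * c ^ ν / c₁) * μ (ball x r) := by
  calc μ (ball x (c * r)) ≤ ENNReal.ofReal (c₂ * (c * r) ^ ν) := (hA x _ (by positivity)).2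
    _ = ENNReal.ofReal (c₂ * c ^ ν / c₁) * ENNReal.ofReal (c₁ * r ^ ν) := by
        rw [← ENNReal.ofReal_mul (by positivity), Real.mul_rpow hc.le hr.le]
        congr 1
        field_simp
    _ ≤ _ := by gcongr; exact (hA x r hr).1

/-- Weak type `(1,1)` of the uncentred maximal function. -/
lemma measure_lt_maximalFn_le (hA : IsAhlfors μ c₁ c₂ ν) (hc₁ : 0 < c₁) (hc₂ : 0 < c₂)
    (hν : 0 < ν) (h : X → ℝ≥0∞) {t : ℝ} (ht : 0 < t) :
    ENNReal.ofReal t * μ {x | ENNReal.ofReal t < maximalFn μ h x} ≤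
      ENNReal.ofReal (c₂ * 6 ^ ν / c₁) * ∫⁻ x, h x ∂μ := by
  have hSC := hA.secondCountableTopology hc₁
  have hpos : 0 < c₂ * 6 ^ ν / c₁ := by positivity
  rcases eq_or_ne (∫⁻ x, h x ∂μ) ∞ with htop | hfin
  · rw [htop, ENNReal.mul_top (ENNReal.ofReal_pos.2 hpos).ne']
    exact le_top
  set T : Set (X × ℝ) := {a | 0 < a.2 ∧
    ENNReal.ofReal t * μ (ball a.1 a.2) < ∫⁻ y in ball a.1 a.2, h y ∂μ} with hT
  obtain ⟨R, hR⟩ : ∃ R : ℝ, ∀ a ∈ T, a.2 ≤ R := by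
    refine ⟨((∫⁻ x, h x ∂μ).toReal / (t * c₁)) ^ (1 / ν), fun a ha => ?_⟩
    have h1 : ENNReal.ofReal (t * (c₁ * a.2 ^ ν)) ≤ ∫⁻ x, h x ∂μ := by
      rw [ENNReal.ofReal_mul ht.le]
      calc _ ≤ ENNReal.ofReal t * μ (ball a.1 a.2) := by gcongr; exact (hA a.1 a.2 ha.1).1
        _ ≤ _ := ha.2.le.trans (setLIntegral_le_lintegral _ _)
    rw [ENNReal.ofReal_le_iff_le_toReal hfin] at h1
    have h2 : a.2 ^ ν ≤ (∫⁻ x, h x ∂μ).toReal / (t * c₁) := by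
      rw [le_div_iff₀ (by positivity)]
      linarith
    have ha0 := ha.1.le
    calc a.2 = (a.2 ^ ν) ^ (1 / ν) := by
          rw [← Real.rpow_mul ha0, mul_one_div_cancel hν.ne', Real.rpow_one]
      _ ≤ _ := by gcongr
  obtain ⟨u, huT, hdisj, hcov⟩ := Vitali.exists_disjoint_subfamily_covering_enlargement_closedBall
    T Prod.fst Prod.snd R hR 5 (by norm_num)
  have hdisj' : u.PairwiseDisjoint fun a => ball a.1 a.2 :=
    hdisj.mono fun a => ball_subset_closedBall
  have hcount : u.Countable := hdisj'.countable_of_isOpen (fun a _ => isOpen_ball)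
    fun a ha => nonempty_ball.2 (huT ha).1
  have hsub : {x | ENNReal.ofReal t < maximalFn μ h x} ⊆ ⋃ a ∈ u, ball a.1 (6 * a.2) := by
    intro x hx
    simp only [Set.mem_ofPred_eq, maximalFn, lt_iSup_iff] at hx
    obtain ⟨z, r, hr, hxz, hlt⟩ := hx
    have hmem : (z, r) ∈ T := by
      refine ⟨hr, ?_⟩
      rwa [mul_comm, ← div_eq_mul_inv, ENNReal.lt_div_iff_mul_lt
        (Or.inl (hA.measure_ball_pos hc₁ z hr).ne') (Or.inl (hA.measure_ball_lt_top z r).ne)] at hlt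
    obtain ⟨b, hb, hsub⟩ := hcov _ hmem
    refine Set.mem_biUnion hb ?_
    have h1 := hsub (ball_subset_closedBall hxz)
    exact closedBall_subset_ball (by linarith [(huT hb).1]) h1
  have := hcount.to_subtype
  calc ENNReal.ofReal t * μ {x | ENNReal.ofReal t < maximalFn μ h x}
      ≤ ENNReal.ofReal t * ∑' a : u, μ (ball (a : X × ℝ).1 (6 * (a : X × ℝ).2)) := by
        gcongr
        exact (measure_mono hsub).trans (measure_biUnion_le μ hcount _)
    _ ≤ ENNReal.ofReal t * ∑' a : u, ENNReal.ofReal (c₂ * 6 ^ ν / c₁) *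
          μ (ball (a : X × ℝ).1 (a : X × ℝ).2) := by
        gcongr with a
        exact hA.measure_ball_mul_le hc₁ hc₂ _ (by norm_num) (huT a.2).1
    _ = ENNReal.ofReal (c₂ * 6 ^ ν / c₁) *
          ∑' a : u, ENNReal.ofReal t * μ (ball (a : X × ℝ).1 (a : X × ℝ).2) := by
        rw [ENNReal.tsum_mul_left, ENNReal.tsum_mul_left]
        ring
    _ ≤ ENNReal.ofReal (c₂ * 6 ^ ν / c₁) *
          ∑' a : u, ∫⁻ y in ball (a : X × ℝ).1 (a : X × ℝ).2, h y ∂μ := by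
        gcongr with a
        exact (huT a.2).2.le
    _ = ENNReal.ofReal (c₂ * 6 ^ ν / c₁) *
          ∫⁻ y in ⋃ a ∈ u, ball a.1 a.2, h y ∂μ := by
        rw [lintegral_biUnion hcount (fun _ _ => measurableSet_ball) hdisj']
    _ ≤ _ := mul_le_mul_right (setLIntegral_le_lintegral _ _) _

end IsAhlfors

omit [BorelSpace X] in
lemma maximalFn_le_add (μ : Measure X) (h : X → ℝ≥0∞) (s : ℝ≥0∞) (x : X) :
    maximalFn μ h x ≤ maximalFn μ ({y | s < h y}.indicator h) x + s := by
  refine iSup_le fun z => iSup_le fun r => iSup_le fun hr => iSup_le fun hx => ?_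
  have hle : ∀ y, h y ≤ {y | s < h y}.indicator h y + s := by
    intro y
    by_cases hy : s < h y
    · rw [Set.indicator_of_mem (by exact hy)]
      exact le_self_add
    · exact (not_lt.1 hy).trans le_add_self
  calc (μ (ball z r))⁻¹ * ∫⁻ y in ball z r, h y ∂μ
      ≤ (μ (ball z r))⁻¹ * ∫⁻ y in ball z r, ({y | s < h y}.indicator h y + s) ∂μ := by
        gcongr with y
        exact hle y
    _ = (μ (ball z r))⁻¹ * ∫⁻ y in ball z r, {y | s < h y}.indicator h y ∂μ +
          s * ((μ (ball z r))⁻¹ * μ (ball z r)) := by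
        rw [lintegral_add_right _ measurable_const, lintegral_const, Measure.restrict_apply_univ]
        ring
    _ ≤ maximalFn μ ({y | s < h y}.indicator h) x + s * 1 := by
        gcongr
        · exact le_iSup_of_le z (le_iSup_of_le r (le_iSup_of_le hr (le_iSup_of_le hx le_rfl)))
        · exact ENNReal.inv_mul_le_one _
    _ = _ := by rw [mul_one]

lemma le_tsum_two_pow_mul_indicator {v : ℝ≥0∞} {s : ℝ} (hs : 0 < s) (hv : ENNReal.ofReal s < v) :
    v ≤ ∑' k : ℕ, ENNReal.ofReal (2 ^ (k + 1) * s) *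
      {w : ℝ≥0∞ | ENNReal.ofReal (2 ^ k * s) < w}.indicator 1 v := by
  rcases eq_or_ne v ∞ with rfl | hfin
  · have : ∑' _ : ℕ, ENNReal.ofReal s = ∞ :=
      ENNReal.tsum_const_eq_top_of_ne_zero (ENNReal.ofReal_pos.2 hs).ne'
    refine this.ge.trans (ENNReal.tsum_le_tsum fun k => ?_)
    rw [Set.indicator_of_mem (by exact ENNReal.ofReal_lt_top), Pi.one_apply, mul_one]
    refine ENNReal.ofReal_le_ofReal ?_
    have : (1 : ℝ) ≤ 2 ^ (k + 1) := one_le_pow₀ (by norm_num)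
    nlinarith
  · have hv0 : s < v.toReal := (ENNReal.ofReal_lt_iff_lt_toReal hs.le hfin).1 hv
    obtain ⟨k, hk1, hk2⟩ : ∃ k : ℕ, 2 ^ k * s < v.toReal ∧ v.toReal ≤ 2 ^ (k + 1) * s := by
      have hex : ∃ n : ℕ, v.toReal ≤ 2 ^ n * s := by
        obtain ⟨n, hn⟩ := pow_unbounded_of_one_lt (v.toReal / s) (one_lt_two)
        exact ⟨n, ((div_lt_iff₀ hs).1 hn).le⟩
      classical
      have hne : Nat.find hex ≠ 0 := by
        intro h0
        have := Nat.find_spec hex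
        rw [h0] at this
        simp at this
        linarith
      obtain ⟨k, hk⟩ := Nat.exists_eq_succ_of_ne_zero hne
      refine ⟨k, not_le.1 (Nat.find_min hex (by omega)), ?_⟩
      have := Nat.find_spec hex
      rwa [hk] at this
    refine le_trans ?_ (ENNReal.le_tsum k)
    rw [Set.indicator_of_mem, Pi.one_apply, mul_one]
    · exact ENNReal.le_ofReal_iff_toReal_le hfin (by positivity) |>.2 hk2
    · exact (ENNReal.ofReal_lt_iff_lt_toReal (by positivity) hfin).2 hk1

namespace IsAhlfors

variable {μ : Measure X} {c₁ c₂ ν : ℝ}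

/-- The distribution function of the maximal function is controlled by dyadic dilates of the
distribution function of the original function. -/
lemma measure_lt_maximalFn_le_tsum (hA : IsAhlfors μ c₁ c₂ ν) (hc₁ : 0 < c₁) (hc₂ : 0 < c₂)
    (hν : 0 < ν) {h : X → ℝ≥0∞} (hh : Measurable h) {t : ℝ} (ht : 0 < t) :
    μ {x | ENNReal.ofReal t < maximalFn μ h x} ≤
      ENNReal.ofReal (c₂ * 6 ^ ν / c₁) *
        ∑' k : ℕ, 2 ^ (k + 1) * μ {x | ENNReal.ofReal (2 ^ k * (t / 2)) < h x} := by
  set s := t / 2 with hs_def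
  have hs : 0 < s := by positivity
  have hs0 : ENNReal.ofReal s ≠ 0 := (ENNReal.ofReal_pos.2 hs).ne'
  set h' := {y | ENNReal.ofReal s < h y}.indicator h with hh'
  have hts : ENNReal.ofReal t = ENNReal.ofReal s + ENNReal.ofReal s := by
    rw [← ENNReal.ofReal_add hs.le hs.le, hs_def, add_halves]
  have hsub : {x | ENNReal.ofReal t < maximalFn μ h x} ⊆
      {x | ENNReal.ofReal s < maximalFn μ h' x} := by
    intro x hx
    have := lt_of_lt_of_le (show ENNReal.ofReal t < _ from hx) (maximalFn_le_add μ h (ENNReal.ofReal s) x)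
    rw [hts] at this
    exact lt_of_add_lt_add_right this
  have hfi : ∫⁻ x, h' x ∂μ ≤ ENNReal.ofReal s *
      ∑' k : ℕ, 2 ^ (k + 1) * μ {x | ENNReal.ofReal (2 ^ k * s) < h x} := by
    have hm : ∀ k : ℕ, MeasurableSet {x | ENNReal.ofReal (2 ^ k * s) < h x} :=
      fun k => measurableSet_lt measurable_const hh
    calc ∫⁻ x, h' x ∂μ ≤ ∫⁻ x, ∑' k : ℕ, ENNReal.ofReal (2 ^ (k + 1) * s) *
          {x | ENNReal.ofReal (2 ^ k * s) < h x}.indicator 1 x ∂μ := by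
          refine lintegral_mono fun x => ?_
          by_cases hx : ENNReal.ofReal s < h x
          · simp only [hh']
            rw [Set.indicator_of_mem (by exact hx)]
            exact le_tsum_two_pow_mul_indicator hs hx
          · simp only [hh']
            rw [Set.indicator_of_notMem (by exact hx)]
            exact zero_le
      _ = _ := by
          rw [lintegral_tsum fun k =>
            ((measurable_one.indicator (hm k)).const_mul _).aemeasurable, ← ENNReal.tsum_mul_left]
          refine tsum_congr fun k => ?_
          rw [lintegral_const_mul _ (measurable_one.indicator (hm k)), lintegral_indicator_one (hm k),
            ENNReal.ofReal_mul (by positivity), ENNReal.ofReal_pow (by norm_num)]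
          simp only [ENNReal.ofReal_ofNat]
          ring
  have hweak := hA.measure_lt_maximalFn_le hc₁ hc₂ hν h' hs
  have := (mul_le_mul_right (measure_mono (μ := μ) hsub) (ENNReal.ofReal s)).trans
    (hweak.trans (mul_le_mul_right hfi _))
  rw [mul_left_comm, ENNReal.mul_le_mul_iff_right hs0 ENNReal.ofReal_ne_top] at this
  exact this

end IsAhlfors

lemma lintegral_Ioi_comp_mul_rpow (F : ℝ → ℝ≥0∞) {c θ : ℝ} (hc : 0 < c) (hθ : 0 < θ) :
    ∫⁻ a in Set.Ioi (0 : ℝ), F (c * a ^ θ) * ENNReal.ofReal a⁻¹ =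
      ENNReal.ofReal θ⁻¹ * ∫⁻ u in Set.Ioi (0 : ℝ), F u * ENNReal.ofReal u⁻¹ := by
  have himg : (fun a : ℝ => c * a ^ θ) '' Set.Ioi 0 = Set.Ioi 0 := by
    ext u
    constructor
    · rintro ⟨a, ha, rfl⟩
      have : (0 : ℝ) < a := ha
      exact Set.mem_Ioi.2 (by positivity)
    · intro hu
      have hu : (0 : ℝ) < u := hu
      refine ⟨(u / c) ^ (1 / θ), Set.mem_Ioi.2 (by positivity), ?_⟩
      simp only
      rw [← Real.rpow_mul (by positivity), one_div_mul_cancel hθ.ne', Real.rpow_one,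
        mul_div_cancel₀ _ hc.ne']
  have hinj : Set.InjOn (fun a : ℝ => c * a ^ θ) (Set.Ioi 0) := by
    intro a ha b hb hab
    have ha : (0 : ℝ) < a := ha
    have hb : (0 : ℝ) < b := hb
    exact Real.rpow_left_injOn hθ.ne' ha.le hb.le (mul_left_cancel₀ hc.ne' hab)
  have hderiv : ∀ a ∈ Set.Ioi (0 : ℝ), HasDerivWithinAt (fun a : ℝ => c * a ^ θ)
      (c * (θ * a ^ (θ - 1))) (Set.Ioi 0) a := fun a ha =>
    ((Real.hasDerivAt_rpow_const (Or.inl (ne_of_gt ha))).const_mul c).hasDerivWithinAt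
  have key := lintegral_image_eq_lintegral_abs_deriv_mul measurableSet_Ioi hderiv hinj
    (fun u => F u * ENNReal.ofReal u⁻¹)
  rw [himg] at key
  rw [key, ← lintegral_const_mul' _ _ ENNReal.ofReal_ne_top]
  refine setLIntegral_congr_fun measurableSet_Ioi fun a ha => ?_
  have ha : (0 : ℝ) < a := ha
  have haθ : a ^ (θ - 1) = a ^ θ / a := by rw [Real.rpow_sub ha, Real.rpow_one]
  rw [abs_of_pos (by positivity), mul_left_comm, mul_left_comm (ENNReal.ofReal θ⁻¹),
    mul_left_comm, ← ENNReal.ofReal_mul (by positivity), ← ENNReal.ofReal_mul (by positivity), haθ]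
  congr 2
  field_simp

lemma tsum_rpow_le_tsum_rpow {β η : ℝ} (hβ : 0 < β) (hη : 0 < η) :
    ∃ C : ℝ≥0∞, C ≠ ∞ ∧ ∀ a : ℕ → ℝ≥0∞,
      (∑' k, a k) ^ β ≤ C * ∑' k : ℕ, ((2 : ℝ≥0∞) ^ (η * k) * a k) ^ β := by
  have hpow : ∀ k : ℕ, (2 : ℝ≥0∞) ^ (-(η * k)) = ((2 : ℝ≥0∞) ^ (-η)) ^ k := fun k => by
    rw [← ENNReal.rpow_natCast, ← ENNReal.rpow_mul, neg_mul]
  refine ⟨(∑' k : ℕ, (2 : ℝ≥0∞) ^ (-(η * k))) ^ β, ENNReal.rpow_ne_top_of_nonneg hβ.le ?_,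
    fun a => ?_⟩
  · simp_rw [hpow]
    exact (tsum_geometric_lt_top.2
      (ENNReal.rpow_lt_one_of_one_lt_of_neg (by norm_num) (by linarith))).ne
  · set S := (∑' k : ℕ, ((2 : ℝ≥0∞) ^ (η * k) * a k) ^ β) with hS
    have hle : ∀ k : ℕ, (2 : ℝ≥0∞) ^ (η * k) * a k ≤ S ^ (1 / β) := fun k => by
      rw [one_div, ENNReal.le_rpow_inv_iff hβ]
      exact ENNReal.le_tsum k
    have : ∑' k, a k ≤ (∑' k : ℕ, (2 : ℝ≥0∞) ^ (-(η * k))) * S ^ (1 / β) := by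
      rw [← ENNReal.tsum_mul_right]
      refine ENNReal.tsum_le_tsum fun k => ?_
      calc a k = 2 ^ (-(η * k)) * (2 ^ (η * k) * a k) := by
            rw [← mul_assoc, ← ENNReal.rpow_add _ _ (by norm_num) (by norm_num)]
            simp
        _ ≤ _ := by gcongr; exact hle k
    calc (∑' k, a k) ^ β ≤ ((∑' k : ℕ, (2 : ℝ≥0∞) ^ (-(η * k))) * S ^ (1 / β)) ^ β := by gcongr
      _ = _ := by
        rw [ENNReal.mul_rpow_of_nonneg _ _ hβ.le, ← ENNReal.rpow_mul, one_div_mul_cancel hβ.ne',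
          ENNReal.rpow_one]

lemma lorentzNormE_zero {X : Type*} [MeasurableSpace X] (μ : Measure X) {r m : ℝ} (hr : 0 < r)
    (hm : 0 < m) : lorentzNormE μ r m 0 = 0 := by
  simp [lorentzNormE, hr, hm, ENNReal.zero_rpow_of_pos]

/-- The integral over dilates of a Lorentz-type integrand, in terms of the original one. -/
lemma lintegral_lorentz_dilate (w : ℝ → ℝ≥0∞) {θ r m c : ℝ} (hθ : 0 < θ)
    (hm : 0 < m) (hc : 0 < c) :
    ∫⁻ a in Set.Ioi (0 : ℝ), ENNReal.ofReal a ^ m * w (c * a ^ (1 / θ)) ^ (m / r) *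
        ENNReal.ofReal a⁻¹ =
      ENNReal.ofReal (c ^ (-(θ * m))) * (ENNReal.ofReal θ *
        ∫⁻ u in Set.Ioi (0 : ℝ), (ENNReal.ofReal u * w u ^ (1 / (θ * r))) ^ (θ * m) *
          ENNReal.ofReal u⁻¹) := by
  have h := lintegral_Ioi_comp_mul_rpow
    (fun u => (ENNReal.ofReal u * w u ^ (1 / (θ * r))) ^ (θ * m)) hc (one_div_pos.2 hθ)
  rw [one_div, inv_inv] at h
  rw [← h, ← lintegral_const_mul' _ _ ENNReal.ofReal_ne_top]
  refine setLIntegral_congr_fun measurableSet_Ioi fun a ha => ?_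
  have ha : (0 : ℝ) < a := ha
  simp only [one_div]
  rw [ENNReal.mul_rpow_of_nonneg _ _ (by positivity), ← ENNReal.rpow_mul,
    show (θ * r)⁻¹ * (θ * m) = m / r by field_simp,
    ENNReal.ofReal_rpow_of_pos ha, ENNReal.ofReal_rpow_of_pos (by positivity), ← mul_assoc,
    ← mul_assoc, ← ENNReal.ofReal_mul (by positivity)]
  congr 3
  rw [Real.mul_rpow hc.le (by positivity), ← mul_assoc, ← Real.rpow_add hc, ← Real.rpow_mul ha.le,
    show θ⁻¹ * (θ * m) = m by field_simp]
  simp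

namespace IsAhlfors

variable {μ : Measure X} {c₁ c₂ ν : ℝ}

/-- A function dominated by a power `θ` of the maximal function of `g` satisfies a Lorentz bound
in terms of `g`. -/
lemma lorentzNormE_le_of_le_maximalFn_rpow (hA : IsAhlfors μ c₁ c₂ ν) (hc₁ : 0 < c₁)
    (hc₂ : 0 < c₂) (hν : 0 < ν) {θ r m : ℝ} (hθ : 0 < θ) (hr : 1 < θ * r) (hm : 0 < m) :
    ∃ C : ℝ≥0∞, C ≠ ∞ ∧ ∀ (g F : X → ℝ≥0∞) (A : ℝ≥0∞), Measurable g → A ≠ ∞ →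
      (∀ x, F x ≤ A * maximalFn μ g x ^ θ) →
        lorentzNormE μ r m F ≤ C * A * lorentzNormE μ (θ * r) (θ * m) g ^ θ := by
  have hr0 : 0 < r := pos_of_mul_pos_right (one_pos.trans hr) hθ.le
  set β := m / r with hβ_def
  have hβ : 0 < β := div_pos hm hr0
  set η := (θ * r - 1) / 2 with hη_def
  have hη : 0 < η := by rw [hη_def]; linarith
  obtain ⟨C₁, hC₁, hsum⟩ := tsum_rpow_le_tsum_rpow hβ hη
  set C₀ := ENNReal.ofReal (c₂ * 6 ^ ν / c₁) with hC₀
  set S := ∑' k : ℕ, ((2 : ℝ≥0∞) ^ (η * k) * 2 ^ (k + 1)) ^ β *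
    ENNReal.ofReal ((2 ^ k / 2 : ℝ) ^ (-(θ * m))) with hS_def
  have hS : S ≠ ∞ := by
    have heq : ∀ k : ℕ, ((2 : ℝ≥0∞) ^ (η * k) * 2 ^ (k + 1)) ^ β *
        ENNReal.ofReal ((2 ^ k / 2 : ℝ) ^ (-(θ * m))) =
        2 ^ (β + θ * m) * ((2 : ℝ≥0∞) ^ (-(β * η))) ^ k := by
      intro k
      have h2 : (2 ^ k / 2 : ℝ) = 2 ^ ((k : ℝ) - 1) := by
        rw [Real.rpow_sub (by norm_num), Real.rpow_natCast, Real.rpow_one]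
      rw [h2, ← Real.rpow_mul (by norm_num), ← ENNReal.ofReal_rpow_of_pos (by norm_num),
        ENNReal.ofReal_ofNat, ← ENNReal.rpow_natCast 2 (k + 1), ← ENNReal.rpow_natCast,
        ← ENNReal.rpow_add _ _ (by norm_num) (by norm_num), ← ENNReal.rpow_mul,
        ← ENNReal.rpow_mul,
        ← ENNReal.rpow_add _ _ (by norm_num) (by norm_num),
        ← ENNReal.rpow_add _ _ (by norm_num) (by norm_num)]
      congr 1
      have : θ * m = β * (2 * η + 1) := by
        rw [hβ_def, hη_def]; field_simp; ring
      rw [this]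
      push_cast
      ring
    simp_rw [hS_def, heq, ENNReal.tsum_mul_left]
    refine ENNReal.mul_ne_top (ENNReal.rpow_ne_top_of_nonneg (by positivity) (by norm_num)) ?_
    exact (tsum_geometric_lt_top.2
      (ENNReal.rpow_lt_one_of_one_lt_of_neg (by norm_num) (by nlinarith))).ne
  set C₂ := C₀ ^ β * (C₁ * (S * ENNReal.ofReal θ)) with hC₂
  have hC₂top : C₂ ≠ ∞ := by
    refine ENNReal.mul_ne_top (ENNReal.rpow_ne_top_of_nonneg hβ.le ENNReal.ofReal_ne_top) ?_
    exact ENNReal.mul_ne_top hC₁ (ENNReal.mul_ne_top hS ENNReal.ofReal_ne_top)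
  refine ⟨ENNReal.ofReal (r ^ (1 / m)) * C₂ ^ (1 / m), ENNReal.mul_ne_top ENNReal.ofReal_ne_top
    (ENNReal.rpow_ne_top_of_nonneg (by positivity) hC₂top), fun g F A hg hAtop hF => ?_⟩
  rcases eq_or_ne A 0 with rfl | hA0
  · have : F = 0 := funext fun x => by simpa using hF x
    rw [this, lorentzNormE_zero μ hr0 hm]
    exact zero_le
  obtain ⟨a, ha, rfl⟩ : ∃ a : ℝ, 0 < a ∧ A = ENNReal.ofReal a :=
    ⟨A.toReal, ENNReal.toReal_pos hA0 hAtop, (ENNReal.ofReal_toReal hAtop).symm⟩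
  set w : ℝ → ℝ≥0∞ := fun t => μ {x | ENNReal.ofReal t < g x} with hw
  have hwanti : Antitone w := fun s t hst => measure_mono fun x hx =>
    (ENNReal.ofReal_le_ofReal hst).trans_lt hx
  set I := ∫⁻ u in Set.Ioi (0 : ℝ), (ENNReal.ofReal u * w u ^ (1 / (θ * r))) ^ (θ * m) *
          ENNReal.ofReal u⁻¹ with hI
  set c : ℕ → ℝ := fun k => 2 ^ k / 2 * a ^ (-(1 / θ)) with hc_def
  have hc : ∀ k, 0 < c k := fun k => by positivity
  have hdist : ∀ t : ℝ, 0 < t → μ {x | ENNReal.ofReal t < F x} ≤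
      C₀ * ∑' k : ℕ, 2 ^ (k + 1) * w (c k * t ^ (1 / θ)) := by
    intro t ht
    have hsub : {x | ENNReal.ofReal t < F x} ⊆
        {x | ENNReal.ofReal ((t / a) ^ (1 / θ)) < maximalFn μ g x} := by
      intro x hx
      have h1 : ENNReal.ofReal t < ENNReal.ofReal a * maximalFn μ g x ^ θ :=
        lt_of_lt_of_le (show ENNReal.ofReal t < F x from hx) (hF x)
      have h2 : ENNReal.ofReal (t / a) < maximalFn μ g x ^ θ := by
        rw [ENNReal.ofReal_div_of_pos ha]
        exact ENNReal.div_lt_of_lt_mul' h1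
      rw [Set.mem_ofPred_eq, ← ENNReal.ofReal_rpow_of_pos (by positivity), one_div]
      exact (ENNReal.rpow_inv_lt_iff hθ).2 h2
    refine (measure_mono hsub).trans ((hA.measure_lt_maximalFn_le_tsum hc₁ hc₂ hν hg
      (by positivity)).trans_eq ?_)
    congr 1
    refine tsum_congr fun k => ?_
    have : (2 : ℝ) ^ k * ((t / a) ^ (1 / θ) / 2) = c k * t ^ (1 / θ) := by
      rw [hc_def, Real.div_rpow ht.le ha.le, Real.rpow_neg ha.le]
      field_simp
    simp only [hw, this]
  have hJ : ∫⁻ t in Set.Ioi (0 : ℝ),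
      (ENNReal.ofReal t * μ {x | ENNReal.ofReal t < F x} ^ (1 / r)) ^ m * ENNReal.ofReal t⁻¹ ≤
      C₂ * ENNReal.ofReal a ^ m * I := by
    calc _ ≤ ∫⁻ t in Set.Ioi (0 : ℝ), C₀ ^ β * (C₁ * ∑' k : ℕ,
          ((2 : ℝ≥0∞) ^ (η * k) * 2 ^ (k + 1)) ^ β *
            (ENNReal.ofReal t ^ m * w (c k * t ^ (1 / θ)) ^ (m / r) * ENNReal.ofReal t⁻¹)) := by
          refine setLIntegral_mono' measurableSet_Ioi fun t ht => ?_
          rw [ENNReal.mul_rpow_of_nonneg _ _ hm.le, ← ENNReal.rpow_mul,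
            show 1 / r * m = β by rw [hβ_def]; ring]
          calc ENNReal.ofReal t ^ m * μ {x | ENNReal.ofReal t < F x} ^ β * ENNReal.ofReal t⁻¹
              ≤ ENNReal.ofReal t ^ m * (C₀ ^ β * (C₁ * ∑' k : ℕ, ((2 : ℝ≥0∞) ^ (η * k) *
                  (2 ^ (k + 1) * w (c k * t ^ (1 / θ)))) ^ β)) * ENNReal.ofReal t⁻¹ := by
                gcongr
                refine (ENNReal.rpow_le_rpow (hdist t ht) hβ.le).trans ?_
                rw [ENNReal.mul_rpow_of_nonneg _ _ hβ.le]
                gcongr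
                exact hsum _
            _ = _ := by
                have : ∀ x y z : ℝ≥0∞, x * (C₀ ^ β * (C₁ * y)) * z =
                    C₀ ^ β * (C₁ * ((x * z) * y)) := fun x y z => by ring
                rw [this, ← ENNReal.tsum_mul_left]
                congr 2
                refine tsum_congr fun k => ?_
                rw [← mul_assoc ((2 : ℝ≥0∞) ^ (η * k)), ENNReal.mul_rpow_of_nonneg _ _ hβ.le]
                ring
      _ = C₀ ^ β * (C₁ * ∑' k : ℕ, ((2 : ℝ≥0∞) ^ (η * k) * 2 ^ (k + 1)) ^ β *
            (ENNReal.ofReal (c k ^ (-(θ * m))) * (ENNReal.ofReal θ * I))) := by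
          have hmeas : ∀ k, Measurable fun t : ℝ =>
              ENNReal.ofReal t ^ m * w (c k * t ^ (1 / θ)) ^ (m / r) * ENNReal.ofReal t⁻¹ := by
            intro k
            have := hwanti.measurable
            fun_prop
          rw [lintegral_const_mul' _ _
              (ENNReal.rpow_ne_top_of_nonneg hβ.le ENNReal.ofReal_ne_top),
            lintegral_const_mul' _ _ hC₁, lintegral_tsum fun k =>
              ((hmeas k).const_mul _).aemeasurable]
          congr 2
          refine tsum_congr fun k => ?_
          rw [lintegral_const_mul _ (hmeas k), lintegral_lorentz_dilate w hθ hm (hc k)]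
      _ = _ := by
          have hck : ∀ k, ENNReal.ofReal (c k ^ (-(θ * m))) =
              ENNReal.ofReal ((2 ^ k / 2 : ℝ) ^ (-(θ * m))) * ENNReal.ofReal a ^ m := by
            intro k
            rw [hc_def, ENNReal.ofReal_rpow_of_pos ha, ← ENNReal.ofReal_mul (by positivity),
              Real.mul_rpow (by positivity) (by positivity), ← Real.rpow_mul ha.le,
              show -(1 / θ) * -(θ * m) = m by field_simp]
          have hterm : ∀ k : ℕ, ((2 : ℝ≥0∞) ^ (η * k) * 2 ^ (k + 1)) ^ β *
              (ENNReal.ofReal (c k ^ (-(θ * m))) * (ENNReal.ofReal θ * I)) =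
              ((2 : ℝ≥0∞) ^ (η * k) * 2 ^ (k + 1)) ^ β *
                ENNReal.ofReal ((2 ^ k / 2 : ℝ) ^ (-(θ * m))) *
                (ENNReal.ofReal a ^ m * (ENNReal.ofReal θ * I)) := by
            intro k
            rw [hck]
            ring
          simp_rw [hterm, ENNReal.tsum_mul_right, ← hS_def, hC₂]
          ring
  have hL : I ^ (1 / m) ≤ lorentzNormE μ (θ * r) (θ * m) g ^ θ := by
    rw [lorentzNormE, ENNReal.mul_rpow_of_nonneg _ _ hθ.le, ← ENNReal.rpow_mul,
      show 1 / (θ * m) * θ = 1 / m by field_simp]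
    refine le_mul_of_one_le_left zero_le (ENNReal.one_le_rpow ?_ hθ)
    rw [ENNReal.one_le_ofReal]
    exact Real.one_le_rpow hr.le (by positivity)
  calc lorentzNormE μ r m F ≤ ENNReal.ofReal (r ^ (1 / m)) *
        (C₂ * ENNReal.ofReal a ^ m * I) ^ (1 / m) := by
        rw [lorentzNormE]
        gcongr
    _ = ENNReal.ofReal (r ^ (1 / m)) * C₂ ^ (1 / m) * ENNReal.ofReal a * I ^ (1 / m) := by
        rw [ENNReal.mul_rpow_of_nonneg _ _ (by positivity),
          ENNReal.mul_rpow_of_nonneg _ _ (by positivity), ← ENNReal.rpow_mul,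
          mul_one_div_cancel hm.ne', ENNReal.rpow_one]
        ring
    _ ≤ _ := by gcongr

end IsAhlfors

lemma tsum_min_dyadic_le {γ : ℝ} (hγ : 0 < γ) : ∃ C : ℝ≥0∞, C ≠ ∞ ∧ ∀ s : ℝ, 0 < s →
    ∑' k : ℕ, ENNReal.ofReal (min (2 ^ k * s) ((2 ^ k * s) ^ (-γ))) ≤ C := by
  set b : ℤ → ℝ := fun i => min ((2 : ℝ) ^ (i + 1)) (((2 : ℝ) ^ i) ^ (-γ)) with hb
  have hb0 : ∀ i, 0 ≤ b i := fun i => le_min (by positivity) (by positivity)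
  have hsum : Summable b := by
    refine Summable.of_nat_of_neg ?_ ?_
    · refine Summable.of_nonneg_of_le (fun n => hb0 n) (fun n => min_le_right _ _) ?_
      have : ∀ n : ℕ, ((2 : ℝ) ^ (n : ℤ)) ^ (-γ) = ((2 : ℝ) ^ (-γ)) ^ n := fun n => by
        rw [zpow_natCast, ← Real.rpow_natCast_mul (by norm_num), mul_comm,
          Real.rpow_mul_natCast (by norm_num)]
      simp_rw [this]
      exact summable_geometric_of_lt_one (by positivity)
        (Real.rpow_lt_one_of_one_lt_of_neg (by norm_num) (by linarith))
    · refine Summable.of_nonneg_of_le (fun n => hb0 _) (fun n => min_le_left _ _) ?_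
      have : ∀ n : ℕ, (2 : ℝ) ^ (-(n : ℤ) + 1) = (1 / 2) ^ n * 2 := fun n => by
        rw [zpow_add₀ (by norm_num)]
        simp
      simp_rw [this]
      exact summable_geometric_two.mul_right 2
  refine ⟨∑' i, ENNReal.ofReal (b i), hsum.tsum_ofReal_ne_top, fun s hs => ?_⟩
  obtain ⟨j, hj1, hj2⟩ := exists_mem_Ico_zpow hs (one_lt_two : (1 : ℝ) < 2)
  refine le_trans (ENNReal.tsum_le_tsum fun k => ENNReal.ofReal_le_ofReal ?_)
    (ENNReal.tsum_comp_le_tsum_of_injective (f := fun k : ℕ => (k : ℤ) + j)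
      (fun k l hkl => by simpa using hkl) fun i => ENNReal.ofReal (b i))
  refine min_le_min ?_ ?_
  · rw [add_assoc, zpow_add₀ (by norm_num), zpow_natCast]
    gcongr
  · rw [zpow_add₀ (by norm_num), zpow_natCast]
    exact Real.rpow_le_rpow_of_nonpos (by positivity) (by gcongr) (by linarith)

/-- Hedberg-type interpolation for dyadic sums of averages. -/
lemma tsum_dyadic_mul_le {γ : ℝ} (hγ : 0 < γ) : ∃ C : ℝ≥0∞, C ≠ ∞ ∧
    ∀ (a : ℕ → ℝ≥0∞) (M N : ℝ≥0∞) (t : ℝ), 0 < t → (∀ k, a k ≤ M) →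
      (∀ k, a k ≤ ENNReal.ofReal ((2 ^ k * t) ^ (-(1 + γ))) * N) → N ≠ ∞ →
      ∑' k : ℕ, ENNReal.ofReal (2 ^ k * t) * a k ≤
        C * (M ^ (γ / (1 + γ)) * N ^ (1 / (1 + γ))) := by
  obtain ⟨C, hC, hsum⟩ := tsum_min_dyadic_le hγ
  refine ⟨C + 1, by simp [hC], fun a M N t ht hM hN hNtop => ?_⟩
  rcases eq_or_ne M 0 with rfl | hM0
  · have : ∀ k, a k = 0 := fun k => le_antisymm (hM k) zero_le
    simp [this]
  rcases eq_or_ne N 0 with rfl | hN0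
  · have : ∀ k, a k = 0 := fun k => le_antisymm (by simpa using hN k) zero_le
    simp [this]
  rcases eq_or_ne M ∞ with rfl | hMtop
  · rw [ENNReal.top_rpow_of_pos (by positivity), ENNReal.top_mul (by simp [hN0, hNtop]),
      ENNReal.mul_top (by simp)]
    exact le_top
  obtain ⟨M, hMpos, rfl⟩ : ∃ a : ℝ, 0 < a ∧ M = ENNReal.ofReal a :=
    ⟨M.toReal, ENNReal.toReal_pos hM0 hMtop, (ENNReal.ofReal_toReal hMtop).symm⟩
  obtain ⟨N, hNpos, rfl⟩ : ∃ a : ℝ, 0 < a ∧ N = ENNReal.ofReal a :=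
    ⟨N.toReal, ENNReal.toReal_pos hN0 hNtop, (ENNReal.ofReal_toReal hNtop).symm⟩
  set δ := (N / M) ^ (1 / (1 + γ)) with hδ_def
  have hδ : 0 < δ := by positivity
  have hδM : δ * M = M ^ (γ / (1 + γ)) * N ^ (1 / (1 + γ)) := by
    have : M ^ (γ / (1 + γ)) = M * M ^ (-(1 / (1 + γ))) := by
      nth_rewrite 2 [← Real.rpow_one M]
      rw [← Real.rpow_add hMpos]
      congr 1
      field_simp
      ring
    rw [this, hδ_def, Real.div_rpow hNpos.le hMpos.le, Real.rpow_neg hMpos.le]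
    field_simp
  have hδN : δ ^ (-γ) * N = δ * M := by
    have : δ ^ (1 + γ) = N / M := by
      rw [hδ_def, ← Real.rpow_mul (by positivity), one_div_mul_cancel (by positivity),
        Real.rpow_one]
    rw [Real.rpow_add hδ, Real.rpow_one, eq_div_iff hMpos.ne'] at this
    rw [← this, Real.rpow_neg hδ.le]
    field_simp
  have hterm : ∀ k : ℕ, ENNReal.ofReal (2 ^ k * t) * a k ≤
      ENNReal.ofReal (δ * M) *
        ENNReal.ofReal (min (2 ^ k * (t / δ)) ((2 ^ k * (t / δ)) ^ (-γ))) := by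
    intro k
    rw [← ENNReal.ofReal_mul (by positivity), mul_min_of_nonneg _ _ (by positivity),
      ENNReal.ofReal_min]
    refine le_min ?_ ?_
    · calc _ ≤ ENNReal.ofReal (2 ^ k * t) * ENNReal.ofReal M := by gcongr; exact hM k
        _ = _ := by
          rw [← ENNReal.ofReal_mul (by positivity)]
          congr 1
          field_simp
    · calc _ ≤ ENNReal.ofReal (2 ^ k * t) *
            (ENNReal.ofReal ((2 ^ k * t) ^ (-(1 + γ))) * ENNReal.ofReal N) := by
            gcongr; exact hN k
        _ = _ := by
          rw [← ENNReal.ofReal_mul (by positivity), ← ENNReal.ofReal_mul (by positivity)]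
          congr 1
          rw [← mul_div_assoc, Real.div_rpow (by positivity) hδ.le, neg_add,
            Real.rpow_add (by positivity), Real.rpow_neg_one, ← hδN]
          field_simp
  calc _ ≤ ∑' k : ℕ, ENNReal.ofReal (δ * M) *
        ENNReal.ofReal (min (2 ^ k * (t / δ)) ((2 ^ k * (t / δ)) ^ (-γ))) :=
        ENNReal.tsum_le_tsum hterm
    _ ≤ ENNReal.ofReal (δ * M) * C := by
        rw [ENNReal.tsum_mul_left]
        gcongr
        exact hsum _ (by positivity)
    _ ≤ ENNReal.ofReal (δ * M) * (C + 1) := by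
        gcongr
        exact le_self_add
    _ = _ := by
        rw [hδM, mul_comm, ENNReal.ofReal_mul (by positivity), ENNReal.ofReal_rpow_of_pos hMpos,
          ENNReal.ofReal_rpow_of_pos hNpos]

lemma inv_measure_mul_setLIntegral_le_rpow {X : Type*} [MeasurableSpace X] {μ : Measure X}
    {s : Set X} (h0 : μ s ≠ 0) (htop : μ s ≠ ∞) {h : X → ℝ≥0∞}
    (hh : AEMeasurable h (μ.restrict s)) {p : ℝ} (hp : 1 ≤ p) :
    (μ s)⁻¹ * ∫⁻ y in s, h y ∂μ ≤ ((μ s)⁻¹ * ∫⁻ y in s, h y ^ p ∂μ) ^ (1 / p) := by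
  have : IsProbabilityMeasure ((μ s)⁻¹ • μ.restrict s) :=
    ⟨by simp [ENNReal.inv_mul_cancel h0 htop]⟩
  have key := eLpNorm'_le_eLpNorm'_of_exponent_le (zero_lt_one) hp ((μ s)⁻¹ • μ.restrict s)
    (hh.aestronglyMeasurable.smul_measure _)
  simpa [eLpNorm'] using key

namespace IsAhlfors

variable {μ : Measure X} {c₁ c₂ ν : ℝ}

omit [BorelSpace X] in
lemma average_le_morreyNorm (hA : IsAhlfors μ c₁ c₂ ν) (hc₁ : 0 < c₁) {g : X → ℝ≥0∞}
    (hg : Measurable g) {p q : ℝ} (hp : 1 ≤ p) (hq : 0 < q) (x : X) {t : ℝ} (ht : 0 < t) :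
    (μ (ball x t))⁻¹ * ∫⁻ y in ball x t, g y ∂μ ≤
      ENNReal.ofReal (t ^ (-(ν / q))) *
        (ENNReal.ofReal (c₁ ^ (-(1 / q))) * morreyNorm μ p q g) := by
  have h0 := (hA.measure_ball_pos hc₁ x ht).ne'
  have htop := (hA.measure_ball_lt_top x t).ne
  have hp0 : 0 < p := by linarith
  calc _ ≤ ((μ (ball x t))⁻¹ * ∫⁻ y in ball x t, g y ^ p ∂μ) ^ (1 / p) :=
        inv_measure_mul_setLIntegral_le_rpow h0 htop hg.aemeasurable hp
    _ = μ (ball x t) ^ (-(1 / q)) *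
        (μ (ball x t) ^ (p / q - 1) * ∫⁻ y in ball x t, g y ^ p ∂μ) ^ (1 / p) := by
        rw [ENNReal.mul_rpow_of_nonneg _ _ (by positivity),
          ENNReal.mul_rpow_of_nonneg _ _ (by positivity), ← mul_assoc, ← ENNReal.rpow_mul,
          ← ENNReal.rpow_add _ _ h0 htop, ← ENNReal.rpow_neg_one, ← ENNReal.rpow_mul]
        congr 2
        field_simp
        ring
    _ ≤ ENNReal.ofReal (c₁ * t ^ ν) ^ (-(1 / q)) * morreyNorm μ p q g := by
        refine mul_le_mul' ?_ (le_iSup_of_le x (le_iSup_of_le t (le_iSup_of_le ht le_rfl)))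
        rw [ENNReal.rpow_neg, ENNReal.rpow_neg]
        gcongr
        exact (hA x t ht).1
    _ = _ := by
        rw [ENNReal.ofReal_rpow_of_pos (by positivity), ← mul_assoc,
          ← ENNReal.ofReal_mul (by positivity), Real.mul_rpow hc₁.le (by positivity),
          ← Real.rpow_mul ht.le, mul_comm (c₁ ^ _)]
        congr 4
        ring

end IsAhlfors

section SingularIntegral

variable {μ : Measure X} {c₁ c₂ ν ρ' CP σ CK : ℝ} {f : X → ℝ} {g : X → ℝ≥0∞} {K : X → X → ℝ}

omit [BorelSpace X] in
lemma PoincareSobolev.average_oscillation_le (hPS : PoincareSobolev μ f g ρ' CP σ)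
    (hA : IsAhlfors μ c₁ c₂ ν) (hc₁ : 0 < c₁) (hρ' : 1 ≤ ρ') (hf : AEStronglyMeasurable f μ)
    (x : X) {R : ℝ} (hR : 0 < R) :
    (μ (ball x R))⁻¹ * ∫⁻ y in ball x R, ‖f y - ⨍ z in ball x R, f z ∂μ‖ₑ ∂μ ≤
      ENNReal.ofReal (CP * R) *
        ((μ (ball x (σ * R)))⁻¹ * ∫⁻ y in ball x (σ * R), g y ∂μ) := by
  refine le_trans (inv_measure_mul_setLIntegral_le_rpow (hA.measure_ball_pos hc₁ x hR).ne'
    (hA.measure_ball_lt_top x R).ne ?_ hρ') ((le_of_eq ?_).trans (hPS x R hR))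
  · exact (hf.restrict.sub aestronglyMeasurable_const).enorm
  · simp_rw [Real.enorm_eq_ofReal_abs,
      ENNReal.ofReal_rpow_of_nonneg (abs_nonneg _) (zero_le_one.trans hρ')]

omit [BorelSpace X] in
lemma PoincareSobolev.integrableOn_ball (hPS : PoincareSobolev μ f g ρ' CP σ)
    (hA : IsAhlfors μ c₁ c₂ ν) (hc₁ : 0 < c₁) (hρ' : 1 ≤ ρ') (hσ : 1 ≤ σ)
    (hf : AEStronglyMeasurable f μ) (hg : LocIntE μ g) (x : X) {R : ℝ} (hR : 0 < R) :
    IntegrableOn f (ball x R) μ := by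
  have hosc := hPS.average_oscillation_le hA hc₁ hρ' hf x hR
  have htop := (hA.measure_ball_lt_top x R).ne
  have hfin : ENNReal.ofReal (CP * R) *
      ((μ (ball x (σ * R)))⁻¹ * ∫⁻ y in ball x (σ * R), g y ∂μ) < ∞ := by
    refine ENNReal.mul_lt_top ENNReal.ofReal_lt_top (ENNReal.mul_lt_top ?_ (hg.2 _ _))
    exact ENNReal.inv_lt_top.2 (hA.measure_ball_pos hc₁ x (by positivity))
  have hI : ∫⁻ y in ball x R, ‖f y - ⨍ z in ball x R, f z ∂μ‖ₑ ∂μ < ∞ := by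
    rcases ENNReal.mul_lt_top_iff.1 (hosc.trans_lt hfin) with h | h | h
    · exact h.2
    · exact absurd (ENNReal.inv_eq_zero.1 h) htop
    · simp [h]
  have hsub : IntegrableOn (fun y => f y - ⨍ z in ball x R, f z ∂μ) (ball x R) μ :=
    ⟨hf.restrict.sub aestronglyMeasurable_const, hI⟩
  have hconst : IntegrableOn (fun _ => ⨍ z in ball x R, f z ∂μ) (ball x R) μ :=
    integrableOn_const htop
  exact (hsub.add hconst).congr (ae_of_all _ fun y => by simp)

lemma measurableSet_annulus (x : X) (a b : ℝ) :
    MeasurableSet {y | a < dist x y ∧ dist x y ≤ b} :=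
  (measurableSet_lt measurable_const (continuous_const.dist continuous_id).measurable).inter
    (measurableSet_le (continuous_const.dist continuous_id).measurable measurable_const)

omit [MeasurableSpace X] [BorelSpace X] in
lemma annulus_subset_ball (x : X) {a b R : ℝ} (hbR : b < R) :
    {y | a < dist x y ∧ dist x y ≤ b} ⊆ ball x R := fun y hy => by
  rw [mem_ball, dist_comm]
  exact hy.2.trans_lt hbR

omit [MeasurableSpace X] [BorelSpace X] in
lemma SizeCond.abs_le (hsize : SizeCond K CK ν) (hν : 0 ≤ ν) (hCK : 0 ≤ CK) {x y : X} {a : ℝ}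
    (ha : 0 < a) (hy : a < dist x y) : |K x y| ≤ CK / a ^ ν := by
  have hxy : x ≠ y := dist_pos.1 (ha.trans hy)
  exact (hsize x y hxy).trans (by gcongr)

lemma SizeCond.integrableOn_mul_annulus (hsize : SizeCond K CK ν)
    (hK : Measurable (Function.uncurry K)) (hν : 0 ≤ ν) (hCK : 0 ≤ CK) (x : X) {a b R : ℝ} (ha : 0 < a) (hbR : b < R) {h : X → ℝ}
    (hh : IntegrableOn h (ball x R) μ) :
    IntegrableOn (fun y => K x y * h y) {y | a < dist x y ∧ dist x y ≤ b} μ := by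
  refine Integrable.bdd_mul (c := CK / a ^ ν) (hh.mono_set (annulus_subset_ball x hbR))
    (hK.comp measurable_prodMk_left).aestronglyMeasurable ?_
  filter_upwards [ae_restrict_mem (measurableSet_annulus x a b)] with y hy
  exact hsize.abs_le hν hCK ha hy.1

lemma NullCond.setIntegral_annulus_eq_zero (hnull : NullCond μ K) (hsize : SizeCond K CK ν)
    (hK : Measurable (Function.uncurry K)) (hA : IsAhlfors μ c₁ c₂ ν) (hν : 0 ≤ ν) (hCK : 0 ≤ CK)
    (x : X) {a b : ℝ} (ha : 0 < a) (hab : a < b) :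
    ∫ y in {y | a < dist x y ∧ dist x y ≤ b}, K x y ∂μ = 0 := by
  have hcont : Continuous fun y => dist x y := continuous_const.dist continuous_id
  have hset : {y | a < dist x y ∧ dist x y ≤ b} =
      {y | a < dist x y ∧ dist x y < b + 1} \ {y | b < dist x y ∧ dist x y < b + 1} := by
    ext y
    simp only [Set.mem_ofPred_eq, Set.mem_sdiff, not_and, not_lt]
    constructor
    · rintro ⟨h1, h2⟩
      exact ⟨⟨h1, by linarith⟩, fun h => absurd h2 (not_le.2 h)⟩
    · rintro ⟨⟨h1, h2⟩, h3⟩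
      exact ⟨h1, not_lt.1 fun h => absurd h2 (not_lt.2 (h3 h))⟩
  have hfi : IntegrableOn (fun y => K x y) {y | a < dist x y ∧ dist x y < b + 1} μ := by
    have h1 : IntegrableOn (fun _ => (1 : ℝ)) (ball x (b + 2)) μ :=
      integrableOn_const (hA.measure_ball_lt_top x _).ne
    have := hsize.integrableOn_mul_annulus hK hν hCK x (b := b + 1) ha (by linarith) h1
    simp only [mul_one] at this
    exact this.mono_set fun y hy => ⟨hy.1, hy.2.le⟩
  have hmeas : MeasurableSet {y | b < dist x y ∧ dist x y < b + 1} :=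
    (measurableSet_lt measurable_const hcont.measurable).inter
      (measurableSet_lt hcont.measurable measurable_const)
  rw [hset, setIntegral_sdiff hmeas hfi
    (fun y hy => ⟨hab.trans hy.1, hy.2⟩), hnull x a (b + 1) ha (by linarith),
    hnull x b (b + 1) (ha.trans hab) (by linarith), sub_zero]

/-- On an annulus the kernel only sees the oscillation of the function. -/
lemma NullCond.enorm_setIntegral_annulus_le (hnull : NullCond μ K) (hsize : SizeCond K CK ν)
    (hK : Measurable (Function.uncurry K)) (hA : IsAhlfors μ c₁ c₂ ν) (hν : 0 ≤ ν) (hCK : 0 ≤ CK)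
    (x : X) {a b R : ℝ} (ha : 0 < a) (hab : a < b) (hbR : b < R)
    (hf : IntegrableOn f (ball x R) μ) (c : ℝ) :
    ‖∫ y in {y | a < dist x y ∧ dist x y ≤ b}, K x y * f y ∂μ‖ₑ ≤
      ENNReal.ofReal (CK / a ^ ν) * ∫⁻ y in ball x R, ‖f y - c‖ₑ ∂μ := by
  have hc : IntegrableOn (fun _ => c) (ball x R) μ :=
    integrableOn_const (hA.measure_ball_lt_top x _).ne
  have heq : ∫ y in {y | a < dist x y ∧ dist x y ≤ b}, K x y * f y ∂μ =
      ∫ y in {y | a < dist x y ∧ dist x y ≤ b}, K x y * (f y - c) ∂μ := by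
    simp_rw [mul_sub]
    rw [integral_sub (hsize.integrableOn_mul_annulus hK hν hCK x ha hbR hf)
      (hsize.integrableOn_mul_annulus hK hν hCK x ha hbR hc), integral_mul_const,
      hnull.setIntegral_annulus_eq_zero hsize hK hA hν hCK x ha hab, zero_mul, sub_zero]
  calc _ ≤ ∫⁻ y in {y | a < dist x y ∧ dist x y ≤ b}, ‖K x y * (f y - c)‖ₑ ∂μ := by
        rw [heq]
        exact enorm_integral_le_lintegral_enorm _
    _ ≤ ∫⁻ y in {y | a < dist x y ∧ dist x y ≤ b},
          ENNReal.ofReal (CK / a ^ ν) * ‖f y - c‖ₑ ∂μ := by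
        refine setLIntegral_mono' (measurableSet_annulus x a b) fun y hy => ?_
        rw [enorm_mul, Real.enorm_eq_ofReal_abs]
        gcongr
        exact hsize.abs_le hν hCK ha hy.1
    _ ≤ _ := by
        rw [lintegral_const_mul' _ _ ENNReal.ofReal_ne_top]
        gcongr
        exact annulus_subset_ball x hbR

omit [MeasurableSpace X] [BorelSpace X] in
lemma iUnion_dyadic_annulus (x : X) {ε : ℝ} (hε : 0 < ε) :
    ⋃ k : ℕ, {y | 2 ^ k * ε < dist x y ∧ dist x y ≤ 2 ^ (k + 1) * ε} = {y | ε < dist x y} := by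
  ext y
  simp only [Set.mem_iUnion, Set.mem_ofPred_eq]
  constructor
  · rintro ⟨k, hk, -⟩
    have : (1 : ℝ) ≤ 2 ^ k := one_le_pow₀ (by norm_num)
    nlinarith
  · intro hy
    classical
    have hex : ∃ n : ℕ, dist x y ≤ 2 ^ n * ε := by
      obtain ⟨n, hn⟩ := pow_unbounded_of_one_lt (dist x y / ε) one_lt_two
      exact ⟨n, ((div_lt_iff₀ hε).1 hn).le⟩
    obtain ⟨k, hk⟩ := Nat.exists_eq_succ_of_ne_zero (n := Nat.find hex) fun h0 => by
      have := Nat.find_spec hex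
      rw [h0, pow_zero, one_mul] at this
      linarith
    refine ⟨k, not_le.1 (Nat.find_min hex (by omega)), ?_⟩
    have := Nat.find_spec hex
    rwa [hk] at this

omit [MeasurableSpace X] [BorelSpace X] in
lemma pairwise_disjoint_dyadic_annulus (x : X) {ε : ℝ} (hε : 0 < ε) :
    Pairwise (Function.onFun Disjoint
      fun k : ℕ => {y | 2 ^ k * ε < dist x y ∧ dist x y ≤ 2 ^ (k + 1) * ε}) := by
  refine (pairwise_disjoint_on _).2 fun k l hkl => Set.disjoint_left.2 fun y hk hl => ?_
  have : (2 : ℝ) ^ (k + 1) ≤ 2 ^ l := pow_le_pow_right₀ (by norm_num) hkl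
  have := mul_le_mul_of_nonneg_right this hε.le
  linarith [hk.2, hl.1]

lemma enorm_truncT_le (hA : IsAhlfors μ c₁ c₂ ν) (hc₁ : 0 < c₁) (hc₂ : 0 < c₂) (hν : 0 ≤ ν)
    (hK : Measurable (Function.uncurry K)) (hCK : 0 < CK) (hsize : SizeCond K CK ν)
    (hnull : NullCond μ K) (hf : AEStronglyMeasurable f μ) (hg : LocIntE μ g) (hρ' : 1 ≤ ρ')
    (hCP : 0 < CP) (hσ : 1 ≤ σ) (hPS : PoincareSobolev μ f g ρ' CP σ) (x : X) {ε : ℝ}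
    (hε : 0 < ε) :
    ‖truncT μ K f ε x‖ₑ ≤ ENNReal.ofReal (CK * c₂ * 4 ^ ν * CP) *
      ∑' k : ℕ, ENNReal.ofReal (2 ^ k * (4 * σ * ε)) *
        ((μ (ball x (2 ^ k * (4 * σ * ε))))⁻¹ *
          ∫⁻ y in ball x (2 ^ k * (4 * σ * ε)), g y ∂μ) := by
  by_cases hfi : IntegrableOn (fun y => K x y * f y) {y | ε < dist x y} μ
  swap
  · rw [truncT, integral_undef hfi, enorm_zero]
    exact zero_le
  rw [truncT, ← iUnion_dyadic_annulus x hε, integral_iUnion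
    (fun k => measurableSet_annulus x _ _) (pairwise_disjoint_dyadic_annulus x hε)
    (by rwa [iUnion_dyadic_annulus x hε]), ← ENNReal.tsum_mul_left]
  refine enorm_tsum_le_tsum_enorm.trans (ENNReal.tsum_le_tsum fun k => ?_)
  set s : ℝ := 2 ^ k * ε with hs_def
  have hs : 0 < s := by positivity
  have hR : 0 < 4 * s := by positivity
  have h1 : (2 : ℝ) ^ (k + 1) * ε = 2 * s := by rw [hs_def]; ring
  have h2 : (2 : ℝ) ^ k * (4 * σ * ε) = σ * (4 * s) := by rw [hs_def]; ring
  rw [h1, h2]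
  have h0 := (hA.measure_ball_pos hc₁ x hR).ne'
  have htop := (hA.measure_ball_lt_top x (4 * s)).ne
  calc _ ≤ ENNReal.ofReal (CK / s ^ ν) *
        ∫⁻ y in ball x (4 * s), ‖f y - ⨍ z in ball x (4 * s), f z ∂μ‖ₑ ∂μ :=
        hnull.enorm_setIntegral_annulus_le hsize hK hA hν hCK.le x hs (by linarith) (by linarith)
          (hPS.integrableOn_ball hA hc₁ hρ' hσ hf hg x hR) _
    _ = ENNReal.ofReal (CK / s ^ ν) * (μ (ball x (4 * s)) * ((μ (ball x (4 * s)))⁻¹ *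
        ∫⁻ y in ball x (4 * s), ‖f y - ⨍ z in ball x (4 * s), f z ∂μ‖ₑ ∂μ)) := by
        rw [← mul_assoc (μ (ball x (4 * s))), ENNReal.mul_inv_cancel h0 htop, one_mul]
    _ ≤ ENNReal.ofReal (CK / s ^ ν) * (ENNReal.ofReal (c₂ * (4 * s) ^ ν) *
        (ENNReal.ofReal (CP * (σ * (4 * s))) *
          ((μ (ball x (σ * (4 * s))))⁻¹ * ∫⁻ y in ball x (σ * (4 * s)), g y ∂μ))) := by
        refine mul_le_mul_right (mul_le_mul' (hA x _ hR).2
          ((hPS.average_oscillation_le hA hc₁ hρ' hf x hR).trans ?_)) _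
        exact mul_le_mul' (ENNReal.ofReal_le_ofReal (mul_le_mul_of_nonneg_left
          (le_mul_of_one_le_left hR.le hσ) hCP.le)) le_rfl
    _ = _ := by
        generalize (μ (ball x (σ * (4 * s))))⁻¹ * ∫⁻ y in ball x (σ * (4 * s)), g y ∂μ = Q
        simp only [← mul_assoc]
        rw [← ENNReal.ofReal_mul (by positivity), ← ENNReal.ofReal_mul (by positivity),
          ← ENNReal.ofReal_mul (by positivity), Real.mul_rpow (by norm_num) hs.le]
        congr 2
        field_simp

/-- Pointwise bound of the maximal singular operator by the maximal function and Morrey norm of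
the upper gradient. -/
lemma exists_maxT_le (hA : IsAhlfors μ c₁ c₂ ν) (hc₁ : 0 < c₁) (hc₂ : 0 < c₂) (hν : 0 < ν)
    (hK : Measurable (Function.uncurry K)) (hCK : 0 < CK) (hsize : SizeCond K CK ν)
    (hnull : NullCond μ K) (hf : AEStronglyMeasurable f μ) (hg : LocIntE μ g) (hρ' : 1 ≤ ρ')
    (hCP : 0 < CP) (hσ : 1 ≤ σ) (hPS : PoincareSobolev μ f g ρ' CP σ) {p q : ℝ} (hp : 1 ≤ p)
    (hq : 0 < q) (hqν : q / ν < 1) (hgM : morreyNorm μ p q g < ∞) :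
    ∃ C : ℝ≥0∞, C ≠ ∞ ∧ ∀ x, maxT μ K f x ≤
      C * morreyNorm μ p q g ^ (q / ν) * maximalFn μ g x ^ (1 - q / ν) := by
  have hqν' : q < ν := (div_lt_one hν).1 hqν
  have hγ : 0 < ν / q - 1 := by rw [sub_pos, one_lt_div hq]; exact hqν'
  obtain ⟨C, hC, hsum⟩ := tsum_dyadic_mul_le hγ
  set C₁ := ENNReal.ofReal (c₁ ^ (-(1 / q))) with hC₁
  refine ⟨ENNReal.ofReal (CK * c₂ * 4 ^ ν * CP) * (C * C₁ ^ (q / ν)),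
    ENNReal.mul_ne_top ENNReal.ofReal_ne_top (ENNReal.mul_ne_top hC
      (ENNReal.rpow_ne_top_of_nonneg (by positivity) ENNReal.ofReal_ne_top)),
    fun x => iSup_le fun ε => iSup_le fun hε => ?_⟩
  rw [← Real.enorm_eq_ofReal_abs]
  refine (enorm_truncT_le hA hc₁ hc₂ hν.le hK hCK hsize hnull hf hg hρ' hCP hσ hPS x hε).trans ?_
  have ht : ∀ k : ℕ, 0 < 2 ^ k * (4 * σ * ε) := fun k => by positivity
  have := hsum (fun k => (μ (ball x (2 ^ k * (4 * σ * ε))))⁻¹ *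
      ∫⁻ y in ball x (2 ^ k * (4 * σ * ε)), g y ∂μ) (maximalFn μ g x)
    (C₁ * morreyNorm μ p q g) (4 * σ * ε) (by positivity)
    (fun k => le_iSup_of_le x (le_iSup_of_le _ (le_iSup_of_le (ht k)
      (le_iSup_of_le (mem_ball_self (ht k)) le_rfl))))
    (fun k => by
      rw [add_sub_cancel]
      exact hA.average_le_morreyNorm hc₁ hg.1 hp hq x (ht k))
    (ENNReal.mul_ne_top ENNReal.ofReal_ne_top hgM.ne)
  rw [add_sub_cancel, show (ν / q - 1) / (ν / q) = 1 - q / ν by field_simp,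
    one_div_div, ENNReal.mul_rpow_of_nonneg _ _ (by positivity)] at this
  refine (mul_le_mul_right this _).trans_eq ?_
  ring

end SingularIntegral

/-- Lorentz-space functional inequality:
`‖T^*_K f‖_{L^{r,m}} ≤ C ‖g‖_{L^{(1-q/ν)r,(1-q/ν)m}}^{1-q/ν} ‖g‖_{M^{p,q}}^{q/ν}`. -/
theorem lorentz_functional_inequality
    (μ : Measure X) (c₁ c₂ ν CK CP σ ρ' : ℝ) (K : X → X → ℝ) (f : X → ℝ) (g : X → ℝ≥0∞)
    (hc₁ : 0 < c₁) (hc₁₂ : c₁ ≤ c₂) (hν : 0 < ν) (hA : IsAhlfors μ c₁ c₂ ν)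
    (hbal : (2 : ℝ) ^ (1 - ν) * (c₂ / c₁) < 1)
    (hK : Measurable (Function.uncurry K)) (hCK : 0 < CK)
    (hsize : SizeCond K CK ν) (hnull : NullCond μ K)
    (hf : LocallyIntegrable f μ) (hg : LocIntE μ g)
    (hρ'1 : 1 < ρ') (hρ'ν : ρ' < ν) (hCP : 0 < CP) (hσ : 1 ≤ σ)
    (hPS : PoincareSobolev μ f g ρ' CP σ)
    (p q r m : ℝ) (hp : 1 < p) (hpq : p ≤ q) (hqν : q / ν < 1)
    (hgM : morreyNorm μ p q g < ∞)
    (hr : 1 < (1 - q / ν) * r) (hm : 1 < (1 - q / ν) * m)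
    (hgL : lorentzNormE μ ((1 - q / ν) * r) ((1 - q / ν) * m) g < ∞) :
    ∃ C : ℝ, 0 < C ∧
      lorentzNormE μ r m (maxT μ K f) ≤
        ENNReal.ofReal C * lorentzNormE μ ((1 - q / ν) * r) ((1 - q / ν) * m) g ^ (1 - q / ν) *
          morreyNorm μ p q g ^ (q / ν) := by
  have hc₂ : 0 < c₂ := hc₁.trans_le hc₁₂
  have hq : 0 < q := by linarith
  have hθ : 0 < 1 - q / ν := by linarith
  have hSC := hA.secondCountableTopology hc₁
  obtain ⟨C₁, hC₁, hpt⟩ := exists_maxT_le hA hc₁ hc₂ hν hK hCK hsize hnull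
    hf.aestronglyMeasurable hg hρ'1.le hCP hσ hPS hp.le hq hqν hgM
  obtain ⟨C₂, hC₂, hlor⟩ := hA.lorentzNormE_le_of_le_maximalFn_rpow hc₁ hc₂ hν hθ hr
    (pos_of_mul_pos_right (one_pos.trans hm) hθ.le)
  have hle := hlor g (maxT μ K f) _ hg.1 (ENNReal.mul_ne_top hC₁
    (ENNReal.rpow_ne_top_of_nonneg (by positivity) hgM.ne)) hpt
  refine ⟨(C₂ * C₁).toReal + 1, by positivity, hle.trans ?_⟩
  calc _ = C₂ * C₁ * lorentzNormE μ ((1 - q / ν) * r) ((1 - q / ν) * m) g ^ (1 - q / ν) *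
          morreyNorm μ p q g ^ (q / ν) := by ring
    _ ≤ _ := by
        gcongr
        rw [ENNReal.le_ofReal_iff_toReal_le (ENNReal.mul_ne_top hC₂ hC₁) (by positivity)]
        linarith
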